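/- Suppose σ = 0 and (u,m) is a pair of smooth functions on [0,T]×[0,L] satisfying pointwise u_t − r u + H = 0 and m_t − (G m)_x = 0 on (0,T)×(0,L), with m(t,0) = 0 and u_x(t,L) = 0 for all t ∈ [0,T]. Then for every t ∈ [0,T], ∫₀^L u_x(t,x) m(t,x) dx = e^{r(t−T)} ∫₀^L u_x(T,x) m(T,x) dx. -/

import Mathlib

open Set MeasureTheory intervalIntegral Function

noncomputable section

/-- Spatial derivative `u_x`. -/
def pdx (u : ℝ → ℝ → ℝ) (t x : ℝ) : ℝ := deriv (u t) x

/-- Second spatial derivative `u_xx`. -/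
def pdxx (u : ℝ → ℝ → ℝ) (t x : ℝ) : ℝ := deriv (deriv (u t)) x

/-- Time derivative `u_t`. -/
def pdt (u : ℝ → ℝ → ℝ) (t x : ℝ) : ℝ := deriv (fun s => u s x) t

/-- `η(t) = ∫₀^L m(t,x) dx`. -/
def mfgEta (L : ℝ) (m : ℝ → ℝ → ℝ) (t : ℝ) : ℝ := ∫ x in (0:ℝ)..L, m t x

/-- `f(t) = a(η(t)) + c(η(t)) p̄(t)`. -/
def mfgF (L ε : ℝ) (u m : ℝ → ℝ → ℝ) (t : ℝ) : ℝ :=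
  2 / (2 + ε * mfgEta L m t)
    + (ε / (2 + ε * mfgEta L m t)) * ∫ x in (0:ℝ)..L, pdx u t x * m t x

/-- `G(t,x) = (1/2)(f(t) − u_x(t,x))`. -/
def mfgG (L ε : ℝ) (u m : ℝ → ℝ → ℝ) (t x : ℝ) : ℝ :=
  (1/2) * (mfgF L ε u m t - pdx u t x)

/-- `H(t,x) = G(t,x)²`. -/
def mfgH (L ε : ℝ) (u m : ℝ → ℝ → ℝ) (t x : ℝ) : ℝ := (mfgG L ε u m t x)^2

/-- Standing assumptions on the data. -/
structure MFGData (T L σ r ε : ℝ) (uT m0 : ℝ → ℝ) : Prop where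
  hT : 0 < T
  hL : 0 < L
  hσ : 0 < σ
  hr : 0 < r
  hε : 0 ≤ ε
  uT_smooth : ContDiff ℝ 2 uT
  m0_smooth : ContDiff ℝ 2 m0
  uT_zero : uT 0 = 0
  uT_deriv_L : deriv uT L = 0
  uT_nonneg : ∀ x ∈ Icc (0:ℝ) L, 0 ≤ uT x
  uT_deriv_nonneg : ∀ x ∈ Icc (0:ℝ) L, 0 ≤ deriv uT x
  m0_zero : m0 0 = 0
  m0_L : m0 L = 0
  m0_deriv_L : deriv m0 L = 0
  m0_nonneg : ∀ x ∈ Icc (0:ℝ) L, 0 ≤ m0 x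
  m0_mass : (∫ x in (0:ℝ)..L, m0 x) = 1

/-- A smooth solution of the MFG system \eqref{main system}. -/
structure IsMFGSolution (T L σ r ε : ℝ) (uT m0 : ℝ → ℝ) (u m : ℝ → ℝ → ℝ) : Prop where
  u_smooth : ContDiff ℝ (⊤ : ℕ∞) (uncurry u)
  m_smooth : ContDiff ℝ (⊤ : ℕ∞) (uncurry m)
  hjb : ∀ t ∈ Ioo (0:ℝ) T, ∀ x ∈ Ioo (0:ℝ) L,
    pdt u t x + σ^2/2 * pdxx u t x - r * u t x + mfgH L ε u m t x = 0
  fp : ∀ t ∈ Ioo (0:ℝ) T, ∀ x ∈ Ioo (0:ℝ) L,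
    pdt m t x - σ^2/2 * pdxx m t x
      - deriv (fun y => mfgG L ε u m t y * m t y) x = 0
  m_init : ∀ x ∈ Icc (0:ℝ) L, m 0 x = m0 x
  u_term : ∀ x ∈ Icc (0:ℝ) L, u T x = uT x
  u_bdry : ∀ t ∈ Icc (0:ℝ) T, u t 0 = 0
  m_bdry : ∀ t ∈ Icc (0:ℝ) T, m t 0 = 0
  ux_bdry : ∀ t ∈ Icc (0:ℝ) T, pdx u t L = 0
  m_flux : ∀ t ∈ Icc (0:ℝ) T,
    σ^2/2 * pdx m t L + mfgG L ε u m t L * m t L = 0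

end

/-- The spatial partial derivative as a directional Fréchet derivative. -/
theorem hasDerivAt_fderiv_snd {F : ℝ → ℝ → ℝ} (hF : Differentiable ℝ (uncurry F)) (t x : ℝ) :
    HasDerivAt (F t) (fderiv ℝ (uncurry F) (t, x) (0, 1)) x :=
  (hF (t, x)).hasFDerivAt.comp_hasDerivAt x ((hasDerivAt_const x t).prodMk (hasDerivAt_id x))

/-- The time partial derivative as a directional Fréchet derivative. -/
theorem hasDerivAt_fderiv_fst {F : ℝ → ℝ → ℝ} (hF : Differentiable ℝ (uncurry F)) (t x : ℝ) :
    HasDerivAt (fun s => F s x) (fderiv ℝ (uncurry F) (t, x) (1, 0)) t :=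
  HasFDerivAt.comp_hasDerivAt (l := uncurry F) (f := fun s => (s, x)) t
    (hF (t, x)).hasFDerivAt ((hasDerivAt_id t).prodMk (hasDerivAt_const t x))

theorem hasDerivAt_pdx {F : ℝ → ℝ → ℝ} (hF : Differentiable ℝ (uncurry F)) (t x : ℝ) :
    HasDerivAt (F t) (pdx F t x) x :=
  (hasDerivAt_fderiv_snd hF t x).differentiableAt.hasDerivAt

theorem hasDerivAt_pdt {F : ℝ → ℝ → ℝ} (hF : Differentiable ℝ (uncurry F)) (t x : ℝ) :
    HasDerivAt (fun s => F s x) (pdt F t x) t :=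
  (hasDerivAt_fderiv_fst hF t x).differentiableAt.hasDerivAt

theorem uncurry_pdx_eq {F : ℝ → ℝ → ℝ} (hF : Differentiable ℝ (uncurry F)) :
    uncurry (pdx F) = fun p => fderiv ℝ (uncurry F) p (0, 1) :=
  funext fun p => (hasDerivAt_fderiv_snd hF p.1 p.2).deriv

theorem uncurry_pdt_eq {F : ℝ → ℝ → ℝ} (hF : Differentiable ℝ (uncurry F)) :
    uncurry (pdt F) = fun p => fderiv ℝ (uncurry F) p (1, 0) :=
  funext fun p => (hasDerivAt_fderiv_fst hF p.1 p.2).deriv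

theorem contDiff_pdx {F : ℝ → ℝ → ℝ} (hF : ContDiff ℝ (⊤ : ℕ∞) (uncurry F)) :
    ContDiff ℝ (⊤ : ℕ∞) (uncurry (pdx F)) := by
  rw [uncurry_pdx_eq (hF.differentiable (by simp))]
  exact (hF.fderiv_right (m := (⊤ : ℕ∞)) (by simp)).clm_apply contDiff_const

theorem contDiff_pdt {F : ℝ → ℝ → ℝ} (hF : ContDiff ℝ (⊤ : ℕ∞) (uncurry F)) :
    ContDiff ℝ (⊤ : ℕ∞) (uncurry (pdt F)) := by
  rw [uncurry_pdt_eq (hF.differentiable (by simp))]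
  exact (hF.fderiv_right (m := (⊤ : ℕ∞)) (by simp)).clm_apply contDiff_const

/-- Mixed partial derivatives of a smooth function commute. -/
theorem pdt_pdx_eq_pdx_pdt {F : ℝ → ℝ → ℝ} (hF : ContDiff ℝ (⊤ : ℕ∞) (uncurry F)) (t x : ℝ) :
    pdt (pdx F) t x = pdx (pdt F) t x := by
  have hd : Differentiable ℝ (uncurry F) := hF.differentiable (by simp)
  have hd' : Differentiable ℝ (fderiv ℝ (uncurry F)) :=
    (hF.fderiv_right (m := (⊤ : ℕ∞)) (by simp)).differentiable (by simp)
  have happ (v w : ℝ × ℝ) : fderiv ℝ (fun p => fderiv ℝ (uncurry F) p v) (t, x) w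
      = fderiv ℝ (fderiv ℝ (uncurry F)) (t, x) w v := by
    rw [fderiv_clm_apply (hd' _) (differentiableAt_const _)]
    simp
  have hsymm : IsSymmSndFDerivAt ℝ (uncurry F) (t, x) :=
    hF.contDiffAt.isSymmSndFDerivAt (by
      rw [minSmoothness_of_isRCLikeNormedField]
      exact WithTop.coe_le_coe.2 le_top)
  calc pdt (pdx F) t x
      = uncurry (pdt (pdx F)) (t, x) := rfl
    _ = uncurry (pdx (pdt F)) (t, x) := by
        rw [uncurry_pdt_eq ((contDiff_pdx hF).differentiable (by simp)),
          uncurry_pdx_eq ((contDiff_pdt hF).differentiable (by simp)),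
          uncurry_pdx_eq hd, uncurry_pdt_eq hd]
        simp only [happ]
        exact hsymm.eq _ _
    _ = pdx (pdt F) t x := rfl

/-- Differentiation under the integral sign for a smooth integrand on a compact interval. -/
theorem hasDerivAt_integral_pdt {F : ℝ → ℝ → ℝ} (hF : ContDiff ℝ (⊤ : ℕ∞) (uncurry F))
    (a b t : ℝ) :
    HasDerivAt (fun s => ∫ x in a..b, F s x) (∫ x in a..b, pdt F t x) t := by
  have hsec {f : ℝ → ℝ → ℝ} (hf : Continuous (uncurry f)) (s : ℝ) : Continuous (f s) :=
    hf.comp (Continuous.prodMk_right s)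
  have hc := (contDiff_pdt hF).continuous
  obtain ⟨C, hC⟩ := ((isCompact_closedBall t 1).prod (isCompact_uIcc (a := a) (b := b)))
    |>.exists_bound_of_continuousOn hc.continuousOn
  refine (hasDerivAt_integral_of_dominated_loc_of_deriv_le (μ := volume) (bound := fun _ => C)
    (Metric.closedBall_mem_nhds t one_pos)
    (.of_forall fun s => (hsec hF.continuous s).aestronglyMeasurable)
    ((hsec hF.continuous t).intervalIntegrable _ _)
    (hsec hc t).aestronglyMeasurable
    (.of_forall fun x hx s hs => hC (s, x) ⟨hs, uIoc_subset_uIcc hx⟩)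
    intervalIntegrable_const
    (.of_forall fun x _ s _ => hasDerivAt_pdt (hF.differentiable (by simp)) s x)).2

/-- In the first-order case the time derivative of `u_x m` is `r u_x m + (u_x G m)_x`. -/
theorem hasDerivAt_pdx_mul_flux {L r ε t x : ℝ} {u m : ℝ → ℝ → ℝ}
    (hu : ContDiff ℝ (⊤ : ℕ∞) (uncurry u)) (hm : ContDiff ℝ (⊤ : ℕ∞) (uncurry m))
    (hx : x ∈ Ioo (0 : ℝ) L)
    (hjb : ∀ x ∈ Ioo (0 : ℝ) L, pdt u t x - r * u t x + mfgH L ε u m t x = 0)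
    (hfp : pdt m t x - deriv (fun y => mfgG L ε u m t y * m t y) x = 0) :
    HasDerivAt (fun y => pdx u t y * (mfgG L ε u m t y * m t y))
      (pdt (fun s y => pdx u s y * m s y) t x - r * (pdx u t x * m t x)) x := by
  have hud : Differentiable ℝ (uncurry u) := hu.differentiable (by simp)
  have hmd : Differentiable ℝ (uncurry m) := hm.differentiable (by simp)
  have huxd : Differentiable ℝ (uncurry (pdx u)) := (contDiff_pdx hu).differentiable (by simp)
  have hux := hasDerivAt_pdx huxd t x
  have hG : HasDerivAt (mfgG L ε u m t) (1 / 2 * (0 - pdx (pdx u) t x)) x :=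
    ((hasDerivAt_const x _).sub hux).const_mul _
  have hGm := hG.mul (hasDerivAt_pdx hmd t x)
  have hmt : pdt m t x = deriv (fun y => mfgG L ε u m t y * m t y) x := sub_eq_zero.1 hfp
  have huxt : pdt (pdx u) t x = r * pdx u t x + mfgG L ε u m t x * pdx (pdx u) t x := by
    have heq : pdt u t =ᶠ[nhds x] fun y => r * u t y - mfgG L ε u m t y ^ 2 := by
      filter_upwards [Ioo_mem_nhds hx.1 hx.2] with y hy
      have := hjb y hy
      rw [mfgH] at this
      linarith
    have hrhs : HasDerivAt (fun y => r * u t y - mfgG L ε u m t y ^ 2) _ x :=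
      ((hasDerivAt_pdx hud t x).const_mul r).sub (hG.pow 2)
    rw [pdt_pdx_eq_pdx_pdt hu, pdx, heq.deriv_eq, hrhs.deriv]
    push_cast
    ring
  have hw : pdt (fun s y => pdx u s y * m s y) t x
      = pdt (pdx u) t x * m t x + pdx u t x * pdt m t x :=
    ((hasDerivAt_pdt huxd t x).mul (hasDerivAt_pdt hmd t x)).deriv
  refine (hux.mul hGm.differentiableAt.hasDerivAt).congr_deriv ?_
  rw [hw, huxt, hmt]
  simp only [Pi.mul_apply]
  change _ + _ * deriv (fun y => mfgG L ε u m t y * m t y) x = _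
  ring

/-- in the first-order case σ = 0, the nonlocal term satisfies
∫₀^L u_x(t,x) m(t,x) dx = e^{r(t−T)} ∫₀^L u_x(T,x) m(T,x) dx. -/
theorem mfg_nonlocal_identity_sigma_zero (T L r ε : ℝ)
    (hT : 0 < T) (hL : 0 < L) (hr : 0 < r) (hε : 0 ≤ ε)
    (u m : ℝ → ℝ → ℝ)
    (hu : ContDiff ℝ (⊤ : ℕ∞) (uncurry u)) (hm : ContDiff ℝ (⊤ : ℕ∞) (uncurry m))
    (hjb : ∀ t ∈ Ioo (0:ℝ) T, ∀ x ∈ Ioo (0:ℝ) L,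
      pdt u t x - r * u t x + mfgH L ε u m t x = 0)
    (hfp : ∀ t ∈ Ioo (0:ℝ) T, ∀ x ∈ Ioo (0:ℝ) L,
      pdt m t x - deriv (fun y => mfgG L ε u m t y * m t y) x = 0)
    (hm0 : ∀ t ∈ Icc (0:ℝ) T, m t 0 = 0)
    (huxL : ∀ t ∈ Icc (0:ℝ) T, pdx u t L = 0) :
    ∀ t ∈ Icc (0:ℝ) T,
      (∫ x in (0:ℝ)..L, pdx u t x * m t x)
        = Real.exp (r * (t - T)) * ∫ x in (0:ℝ)..L, pdx u T x * m T x := by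
  have hw : ContDiff ℝ (⊤ : ℕ∞) (uncurry fun s x => pdx u s x * m s x) :=
    (contDiff_pdx hu).mul hm
  have hsec {f : ℝ → ℝ → ℝ} (hf : Continuous (uncurry f)) (s : ℝ) : Continuous (f s) :=
    hf.comp (Continuous.prodMk_right s)
  have hwt := hasDerivAt_integral_pdt hw 0 L
  have hode : ∀ t ∈ Ioo (0 : ℝ) T, (∫ x in (0 : ℝ)..L, pdt (fun s x => pdx u s x * m s x) t x)
      = r * ∫ x in (0 : ℝ)..L, pdx u t x * m t x := by
    intro t ht
    have hwc : Continuous fun x => pdx u t x * m t x := hsec hw.continuous t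
    have hwtc : Continuous fun x => pdt (fun s x => pdx u s x * m s x) t x :=
      hsec (contDiff_pdt hw).continuous t
    have huxc : Continuous (pdx u t) := hsec (contDiff_pdx hu).continuous t
    have hrwc : Continuous fun x => r * (pdx u t x * m t x) := continuous_const.mul hwc
    have hflux : Continuous fun y => pdx u t y * (mfgG L ε u m t y * m t y) :=
      huxc.mul ((continuous_const.mul (continuous_const.sub huxc)).mul (hsec hm.continuous t))
    have hint := integral_eq_sub_of_hasDerivAt_of_le hL.le hflux.continuousOn
      (fun x hx => hasDerivAt_pdx_mul_flux hu hm hx (hjb t ht) (hfp t ht x hx))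
      ((hwtc.sub hrwc).intervalIntegrable _ _)
    rw [integral_sub (hwtc.intervalIntegrable _ _)
      (hrwc.intervalIntegrable _ _), intervalIntegral.integral_const_mul,
      hm0 t (Ioo_subset_Icc_self ht), huxL t (Ioo_subset_Icc_self ht)] at hint
    linarith
  intro t ht
  have hexp (s : ℝ) := ((hasDerivAt_id s).const_mul (-r)).exp.mul (hwt s)
  have hconst := integral_eq_sub_of_hasDerivAt_of_le (f' := fun _ => 0) ht.2
    (HasDerivAt.continuousOn fun s _ => hexp s)
    (fun s hs => (hexp s).congr_deriv (by
      rw [hode s ⟨ht.1.trans_lt hs.1, hs.2⟩]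
      ring))
    intervalIntegrable_const
  simp only [intervalIntegral.integral_zero, Pi.mul_apply, id] at hconst
  have hsplit : Real.exp (r * (t - T)) = Real.exp (r * t) * Real.exp (-r * T) := by
    rw [← Real.exp_add]
    ring_nf
  have hinv : Real.exp (r * t) * Real.exp (-r * t) = 1 := by
    rw [← Real.exp_add]
    simp
  rw [hsplit]
  linear_combination Real.exp (r * t) * hconst
    - (∫ x in (0 : ℝ)..L, pdx u t x * m t x) * hinv
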